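/- arXiv:1601.07304 — 5 statements merged into one kernel-verified Lean document; each statement's English description precedes it below -/
import Mathlib

section
/- Let M be a homogenizable countably infinite structure over a finite relational vocabulary. The following are equivalent: (1) M is boundedly homogenizable; (2) for each finite substructure A ⊆ M there is a finite substructure B with A ⊆ B ⊆ M such that each embedding f: B → M may be extended to an automorphism of M; (3) M is model-complete and for each finite substructure A ⊆ M there is a finite substructure B which is an amalgamation base for Age(M) with A ⊆ B ⊆ M. -/
open FirstOrder FirstOrder.Language CategoryTheory

namespace HomPaper

/-- The language consisting of `n` new relation symbols, the `i`-th of arity `k i`. -/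
def expLang (n : ℕ) (k : Fin n → ℕ) : FirstOrder.Language.{0, 0} where
  Functions := fun _ => Empty
  Relations := fun m => {i : Fin n // k i = m}

variable (L : FirstOrder.Language.{0, 0})

/-- The interpretation of the new relation symbols: the `i`-th symbol is interpreted
by the set defined by the formula `φ i`. -/
def expStructure (M : Type) [L.Structure M] {n : ℕ} {k : Fin n → ℕ}
    (φ : ∀ i : Fin n, L.Formula (Fin (k i))) : (expLang n k).Structure M where
  funMap := fun f _ => f.elim
  RelMap := fun {m} r x => (φ r.1).Realize (x ∘ Fin.cast r.2)

/-- `φ` is a family of homogenizing formulas for `M`: the expansion of `M` by new relation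
symbols interpreted by the sets defined by the `φ i` is a homogeneous structure. -/
def Homogenizes (M : Type) [L.Structure M] {n : ℕ} {k : Fin n → ℕ}
    (φ : ∀ i : Fin n, L.Formula (Fin (k i))) : Prop :=
  letI : (expLang n k).Structure M := expStructure L M φ
  (L.sum (expLang n k)).IsUltrahomogeneous M

/-- `M` is homogenizable. -/
def Homogenizable (M : Type) [L.Structure M] : Prop :=
  ∃ (n : ℕ) (k : Fin n → ℕ) (φ : ∀ i : Fin n, L.Formula (Fin (k i))),
    Homogenizes L M φ

/-- A `Σ₁`-formula: an existentially quantified quantifier-free formula. -/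
def IsSigma1 {α : Type} (φ : L.Formula α) : Prop :=
  ∃ (m : ℕ) (ψ : L.BoundedFormula α m), ψ.IsQF ∧ φ = ψ.exs

/-- `M` is `Σ₁`-homogenizable: homogenizable with `Σ₁` homogenizing formulas. -/
def Sigma1Homogenizable (M : Type) [L.Structure M] : Prop :=
  ∃ (n : ℕ) (k : Fin n → ℕ) (φ : ∀ i : Fin n, L.Formula (Fin (k i))),
    (∀ i, IsSigma1 L (φ i)) ∧ Homogenizes L M φ

/-- `M` is unary homogenizable: homogenizable with homogenizing formulas having
exactly one free variable. -/
def UnaryHomogenizable (M : Type) [L.Structure M] : Prop :=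
  ∃ (n : ℕ) (φ : ∀ _ : Fin n, L.Formula (Fin 1)),
    Homogenizes L M (k := fun _ => 1) φ

/-- Two tuples have the same complete type over `∅`. -/
def SameType (M : Type) [L.Structure M] {m : ℕ} (a b : Fin m → M) : Prop :=
  ∀ φ : L.Formula (Fin m), φ.Realize a ↔ φ.Realize b

/-- The complete type of the tuple `a` over `∅` is isolated by a quantifier-free formula. -/
def QFIsolated (M : Type) [L.Structure M] {m : ℕ} (a : Fin m → M) : Prop :=
  ∃ φ : L.Formula (Fin m), φ.IsQF ∧ φ.Realize a ∧
    ∀ b : Fin m → M, φ.Realize b → SameType L M a b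

/-- `M` is boundedly homogenizable. -/
def BoundedlyHomogenizable (M : Type) [L.Structure M] : Prop :=
  Homogenizable L M ∧
    ∀ (p : ℕ) (a : Fin p → M), ∃ (q : ℕ) (b : Fin q → M),
      QFIsolated L M (Fin.append a b)

/-- `M` is uniformly homogenizable. -/
def UniformlyHomogenizable (M : Type) [L.Structure M] : Prop :=
  Homogenizable L M ∧
    ∃ (p : ℕ) (a : Fin p → M), ∀ (q : ℕ) (b : Fin q → M),
      QFIsolated L M (Fin.append a b)

/-- `M` is `k`-unavoidably homogenizable: every complete `n`-type with `n ≥ k` is isolated by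
a quantifier-free formula. -/
def KUnavoidablyHomogenizable (M : Type) [L.Structure M] (k : ℕ) : Prop :=
  ∀ n : ℕ, k ≤ n → ∀ a : Fin n → M, QFIsolated L M a

/-- `M` is unavoidably homogenizable. -/
def UnavoidablyHomogenizable (M : Type) [L.Structure M] : Prop :=
  ∃ k : ℕ, KUnavoidablyHomogenizable L M k

/-- The age of `M`: the class of all finite structures embeddable into `M`
(i.e. all finite substructures of `M`, up to isomorphism). -/
def FinAge (M : Type) [L.Structure M] : Set (Bundled.{0} L.Structure) :=
  {N | Finite N ∧ Nonempty (N ↪[L] M)}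

/-- The pair of embeddings `f`, `g` has an amalgam in the class `K`. -/
def HasAmalgam (K : Set (Bundled.{0} L.Structure)) {A B C : Type}
    [L.Structure A] [L.Structure B] [L.Structure C]
    (f : A ↪[L] B) (g : A ↪[L] C) : Prop :=
  ∃ D ∈ K, ∃ (f0 : B ↪[L] D) (g0 : C ↪[L] D), ∀ x : A, f0 (f x) = g0 (g x)

/-- `A` is an amalgamation base for the class `K`. -/
def IsAmalgamationBase (K : Set (Bundled.{0} L.Structure)) (A : Type) [L.Structure A] : Prop :=
  ∀ B C : Bundled.{0} L.Structure, B ∈ K → C ∈ K →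
    ∀ (f : A ↪[L] B) (g : A ↪[L] C), HasAmalgam L K f g

/-- The class `K` satisfies `SEAP_{k,m}`. -/
def SEAPAt (K : Set (Bundled.{0} L.Structure)) (k m : ℕ) : Prop :=
  ∀ A B C : Bundled.{0} L.Structure, A ∈ K → B ∈ K → C ∈ K →
    ∀ (f : A ↪[L] B) (g : A ↪[L] C), ¬ HasAmalgam L K f g →
      ∃ A0 : L.Substructure A, Nat.card A0 < k ∧
      ∃ B0 ∈ K, ∃ C0 ∈ K, ∃ (eB : B ↪[L] B0) (eC : C ↪[L] C0),
        Nat.card B0 - Nat.card B < m ∧ Nat.card C0 - Nat.card C < m ∧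
        ¬ HasAmalgam L K ((eB.comp f).comp A0.subtype) ((eC.comp g).comp A0.subtype)

/-- The class `K` satisfies SEAP. -/
def SEAP (K : Set (Bundled.{0} L.Structure)) : Prop :=
  ∃ k m : ℕ, SEAPAt L K k m

/-- `M` is ω-categorical: `Th(M)` has exactly one countable model up to isomorphism. -/
def OmegaCategorical (M : Type) [L.Structure M] : Prop :=
  ∀ N₁ N₂ : ((L.completeTheory M).ModelType : Type 1),
    Countable N₁ → Countable N₂ → Nonempty (N₁ ≃[L] N₂)

/-- `M` is model-complete: every embedding between models of `Th(M)` is elementary. -/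
def ModelComplete (M : Type) [L.Structure M] : Prop :=
  ∀ (N₁ N₂ : ((L.completeTheory M).ModelType : Type 1)) (f : N₁ ↪[L] N₂)
    (p : ℕ) (φ : L.Formula (Fin p)) (x : Fin p → N₁),
    φ.Realize (fun i => f (x i)) ↔ φ.Realize x


/-- `M` is ω-saturated: every type over a finite tuple of parameters from `M` which is
consistent with `Th(M)` (equivalently, finitely realized in `M`) is realized in `M`. -/
def OmegaSaturated (M : Type) [L.Structure M] : Prop :=
  ∀ (p : ℕ) (c : Fin p → M) (S : Set (L.Formula (Fin (p + 1)))),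
    (∀ s : Finset (L.Formula (Fin (p + 1))), ↑s ⊆ S →
      ∃ a : M, ∀ φ ∈ s, φ.Realize (Fin.snoc c a)) →
    ∃ a : M, ∀ φ ∈ S, φ.Realize (Fin.snoc c a)

/-- `M` is ω-stable: over every countable parameter set there are at most countably many
complete types. -/
def OmegaStable (M : Type) [L.Structure M] : Prop :=
  ∀ A : Set M, A.Countable →
    ∀ p : ℕ, Countable ((L[[↥A]].completeTheory M).CompleteType (Fin p))

/-- The complete type of `a` is isolated by a conjunction of (relabelings of) the
homogenizing formulas `φ` and quantifier-free formulas. -/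
def IsolatedByHomConj (M : Type) [L.Structure M] {n : ℕ} {k : Fin n → ℕ}
    (φ : ∀ i : Fin n, L.Formula (Fin (k i))) {p : ℕ} (a : Fin p → M) : Prop :=
  ∃ ψ : L.Formula (Fin p), ψ.IsQF ∧
    ∃ ts : List (Σ i : Fin n, Fin (k i) → Fin p),
      (ψ.Realize a ∧ ∀ t ∈ ts, ((φ t.1).relabel t.2).Realize a) ∧
      ∀ b : Fin p → M,
        (ψ.Realize b ∧ ∀ t ∈ ts, ((φ t.1).relabel t.2).Realize b) → SameType L M a b

/-- `a` and `b` realize the same type over the parameter set `X`. -/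
def EqTypeOver (M : Type) [L.Structure M] (X : Set M) (a b : M) : Prop :=
  ∀ (p : ℕ) (c : Fin p → M), Set.range c ⊆ X →
    ∀ φ : L.Formula (Fin (p + 1)), φ.Realize (Fin.snoc c a) ↔ φ.Realize (Fin.snoc c b)

/-- The algebraic closure in `M` is degenerate: `acl(X) = X` for every `X ⊆ M`. -/
def DegenerateAcl (M : Type) [L.Structure M] : Prop :=
  ∀ (X : Set M) (a : M), {b : M | EqTypeOver L M X a b}.Finite → a ∈ X

/-- The induced structure on a subset of a structure for a relational language. -/
def inducedStructure (M : Type) [L.Structure M] [L.IsRelational] (A : Set M) :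
    L.Structure A where
  funMap := fun f _ => isEmptyElim f
  RelMap := fun r x => Structure.RelMap r fun i => (x i : M)

/-- Elements `a` and `b` satisfy the same atomic formulas in one free variable
(the same atomic diagram). -/
def SameAtomic1 (M : Type) [L.Structure M] (a b : M) : Prop :=
  ∀ φ : L.Formula (Fin 1), φ.IsAtomic →
    (φ.Realize (fun _ => a) ↔ φ.Realize (fun _ => b))

/-- `M` has uniformly homogenizing formulas. -/
def HasUniformlyHomogenizingFormulas (M : Type) [L.Structure M] : Prop :=
  ∃ (n : ℕ) (k m : Fin n → ℕ)
    (ψ : ∀ i : Fin n, L.BoundedFormula (Fin (k i)) (m i)),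
    (∀ i, (ψ i).IsQF) ∧ Homogenizes L M (fun i => (ψ i).exs) ∧
    ∀ i, ∃ w : Fin (m i) → M, ∀ y : Fin (k i) → M,
      (∃ w0 : Fin (m i) → M, (ψ i).Realize y w0) → (ψ i).Realize y w

end HomPaper

namespace HomPaper

theorem comp_append {α β : Type} {p q : ℕ} (f : α → β) (a : Fin p → α) (b : Fin q → α) :
    f ∘ Fin.append a b = Fin.append (f ∘ a) (f ∘ b) :=
  funext fun i => by induction i using Fin.addCases <;> simp

theorem range_append {α : Type} {p q : ℕ} (a : Fin p → α) (b : Fin q → α) :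
    Set.range (Fin.append a b) = Set.range a ∪ Set.range b := by
  rw [← Set.Sum.elim_range, ← Fin.append_comp_sumElim]
  exact (finSumFinEquiv.surjective.range_comp (Fin.append a b)).symm

section AtomicTypes

variable {L : FirstOrder.Language.{0, 0}} {M : Type} [L.Structure M]

/-- The tuples `a` and `b` satisfy the same equalities and the same relations. -/
def AtomicEquiv (L : FirstOrder.Language.{0, 0}) {M : Type} [L.Structure M] {p : ℕ}
    (a b : Fin p → M) : Prop :=
  (∀ i j, a i = a j ↔ b i = b j) ∧
    ∀ (r : Σ n : ℕ, L.Relations n) (t : Fin r.1 → Fin p),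
      Structure.RelMap r.2 (a ∘ t) ↔ Structure.RelMap r.2 (b ∘ t)

/-- A substructure enumerated by `a` embeds along any tuple atomically equivalent to `a`. -/
theorem AtomicEquiv.exists_embedding [L.IsRelational] {p : ℕ} {a b : Fin p → M}
    (h : AtomicEquiv L a b) (S : L.Substructure M) (hS : (S : Set M) = Set.range a) :
    ∃ f : S ↪[L] M, ∀ (i : Fin p) (hi : a i ∈ S), f ⟨a i, hi⟩ = b i := by
  have hex : ∀ x : S, ∃ i, a i = x := fun x => by
    have hx : (x : M) ∈ (S : Set M) := x.2
    rwa [hS] at hx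
  choose c hc using hex
  refine ⟨⟨⟨fun x => b (c x), fun x y hxy => ?_⟩, fun f => isEmptyElim f, fun {n} r x => ?_⟩,
    fun i hi => (h.1 _ _).1 (hc ⟨a i, hi⟩)⟩
  · exact Subtype.ext (by rw [← hc x, ← hc y]; exact (h.1 _ _).2 hxy)
  · have hx : a ∘ (fun i => c (x i)) = fun i => (x i : M) := funext fun i => hc (x i)
    exact (h.2 ⟨n, r⟩ fun i => c (x i)).symm.trans (by rw [hx]; rfl)

/-- Over a finite relational vocabulary there are finitely many atomic types of `p`-tuples. -/
theorem exists_finite_invariant_atomicEquiv [Finite (Σ n : ℕ, L.Relations n)] (p : ℕ) :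
    ∃ (X : Type) (_ : Finite X) (T : (Fin p → M) → X), ∀ a b, T a = T b → AtomicEquiv L a b := by
  refine ⟨(Fin p → Fin p → Prop) × (∀ r : Σ n : ℕ, L.Relations n, (Fin r.1 → Fin p) → Prop),
    inferInstance, fun a => (fun i j => a i = a j, fun r t => Structure.RelMap r.2 (a ∘ t)),
    fun a b hab => ⟨fun i j => ?_, fun r t => ?_⟩⟩
  · exact iff_of_eq (congrFun (congrFun (congrArg Prod.fst hab) i) j)
  · exact iff_of_eq (congrFun (congrFun (congrArg Prod.snd hab) r) t)

theorem isQF_iInf {α β : Type} [Finite β] {n : ℕ} {f : β → L.BoundedFormula α n}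
    (hf : ∀ b, (f b).IsQF) : (BoundedFormula.iInf f).IsQF := by
  have key : ∀ l : List β, ((l.map f).foldr (· ⊓ ·) ⊤).IsQF := fun l => by
    induction l with
    | nil => exact BoundedFormula.IsQF.top
    | cons b l ih => exact (hf b).inf ih
  exact key _

/-- Over a finite relational vocabulary every atomic type is given by a quantifier-free formula. -/
theorem exists_isQF_atomicEquiv [Finite (Σ n : ℕ, L.Relations n)] {p : ℕ} (a : Fin p → M) :
    ∃ θ : L.Formula (Fin p), θ.IsQF ∧ θ.Realize a ∧ ∀ b, θ.Realize b → AtomicEquiv L a b := by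
  classical
  let atom : ((Fin p × Fin p) ⊕ (Σ r : (Σ n : ℕ, L.Relations n), (Fin r.1 → Fin p))) →
      L.Formula (Fin p) :=
    Sum.elim (fun ij => (Term.var ij.1).equal (Term.var ij.2))
      (fun rt => rt.1.2.formula fun i => Term.var (rt.2 i))
  have hatom : ∀ x, (atom x).IsQF := by
    rintro (ij | rt)
    · exact (BoundedFormula.IsAtomic.equal _ _).isQF
    · exact (BoundedFormula.IsAtomic.rel _ _).isQF
  let lit := fun x => if (atom x).Realize a then atom x else (atom x).not
  have hlit : ∀ (b : Fin p → M) x,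
      (lit x).Realize b ↔ ((atom x).Realize a ↔ (atom x).Realize b) := by
    intro b x
    by_cases h : (atom x).Realize a <;> simp [lit, h]
  refine ⟨Formula.iInf lit, isQF_iInf fun x => ?_, ?_, fun b hb => ?_⟩
  · by_cases h : (atom x).Realize a
    · simpa [lit, h] using hatom x
    · simpa [lit, h] using (hatom x).not
  · exact Formula.realize_iInf.2 fun x => (hlit a x).2 Iff.rfl
  · have hb' := fun x => (hlit b x).1 (Formula.realize_iInf.1 hb x)
    refine ⟨fun i j => ?_, fun r t => ?_⟩
    · simpa [atom] using hb' (Sum.inl (i, j))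
    · simpa [atom, Function.comp_def] using hb' (Sum.inr ⟨r, t⟩)

theorem realize_comp_embedding {N P : Type} [L.Structure N] [L.Structure P] {α : Type}
    {φ : L.Formula α} (hφ : φ.IsQF) (f : N ↪[L] P) (v : α → N) :
    φ.Realize (f ∘ v) ↔ φ.Realize v := by
  have h := hφ.realize_embedding f (v := v) (xs := default)
  rwa [Subsingleton.elim (f ∘ (default : Fin 0 → N)) default] at h

theorem sameType_comp_equiv {p : ℕ} (g : M ≃[L] M) (a : Fin p → M) :
    SameType L M a (g ∘ a) :=
  fun φ => (StrongHomClass.realize_formula g φ).symm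

end AtomicTypes

section Homogenizable

variable {L : FirstOrder.Language.{0, 0}} {M : Type} [L.Structure M]

instance (n : ℕ) (k : Fin n → ℕ) : (expLang n k).IsRelational :=
  fun _ => inferInstanceAs (IsEmpty Empty)

theorem finite_relations_sum_expLang [Finite (Σ n : ℕ, L.Relations n)] (n : ℕ) (k : Fin n → ℕ) :
    Finite (Σ m : ℕ, (L.sum (expLang n k)).Relations m) := by
  have : Finite (Σ m : ℕ, (expLang n k).Relations m) :=
    Finite.of_surjective (fun i : Fin n => (⟨k i, i, rfl⟩ : Σ m : ℕ, (expLang n k).Relations m))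
      (by rintro ⟨m, i, rfl⟩; exact ⟨i, rfl⟩)
  exact Finite.of_equiv _ (Equiv.sigmaSumDistrib L.Relations (expLang n k).Relations).symm

/-- Tuples atomically equivalent in a homogeneous expansion are conjugate. -/
theorem Homogenizes.exists_equiv [L.IsRelational] {n : ℕ} {k : Fin n → ℕ}
    {φ : ∀ i : Fin n, L.Formula (Fin (k i))} (h : Homogenizes L M φ) {p : ℕ} {a b : Fin p → M}
    (hab : letI : (expLang n k).Structure M := expStructure L M φ
      AtomicEquiv (L.sum (expLang n k)) a b) :
    ∃ g : M ≃[L] M, g ∘ a = b := by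
  let _ : (expLang n k).Structure M := expStructure L M φ
  let S := Substructure.closure (L.sum (expLang n k)) (Set.range a)
  have hS : (S : Set M) = Set.range a := Substructure.closure_eq_of_isRelational _ _
  obtain ⟨f, hf⟩ := hab.exists_embedding S hS
  obtain ⟨g, hg⟩ := h S (Substructure.fg_closure (Set.finite_range a)) f
  refine ⟨⟨g.toEquiv, fun f => isEmptyElim f, fun {m} r x => g.map_rel (Sum.inl r) x⟩,
    funext fun i => ?_⟩
  have hi : a i ∈ S := Substructure.subset_closure ⟨i, rfl⟩
  exact (DFunLike.congr_fun hg ⟨a i, hi⟩).symm.trans (hf i hi)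

theorem SameType.exists_equiv [L.IsRelational] (hhom : Homogenizable L M) {p : ℕ}
    {a b : Fin p → M} (hab : SameType L M a b) : ∃ g : M ≃[L] M, g ∘ a = b := by
  obtain ⟨n, k, φ, h⟩ := hhom
  refine h.exists_equiv ⟨fun i j => ?_, ?_⟩
  · simpa using hab ((Term.var i).equal (Term.var j))
  · rintro ⟨m, r | r⟩ t
    · exact Formula.realize_rel.symm.trans
        ((hab (r.formula fun i => Term.var (t i))).trans Formula.realize_rel)
    · have hr := hab ((φ r.1).relabel (t ∘ Fin.cast r.2))
      rwa [Formula.realize_relabel, Formula.realize_relabel] at hr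

/-- A homogenizable structure realizes finitely many complete types of `p`-tuples. -/
theorem Homogenizable.exists_finite_invariant_sameType [L.IsRelational]
    [Finite (Σ n : ℕ, L.Relations n)] (hhom : Homogenizable L M) (p : ℕ) :
    ∃ (X : Type) (_ : Finite X) (T : (Fin p → M) → X), ∀ a b, T a = T b → SameType L M a b := by
  obtain ⟨n, k, φ, h⟩ := hhom
  let _ : (expLang n k).Structure M := expStructure L M φ
  have := finite_relations_sum_expLang (L := L) n k
  obtain ⟨X, hX, T, hT⟩ :=
    exists_finite_invariant_atomicEquiv (L := L.sum (expLang n k)) (M := M) p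
  refine ⟨X, hX, T, fun a b hab => ?_⟩
  obtain ⟨g, rfl⟩ := h.exists_equiv (hT a b hab)
  exact sameType_comp_equiv g a

end Homogenizable

section Extension

variable {L : FirstOrder.Language.{0, 0}} {M : Type} [L.Structure M]

/-- Every finite substructure of `M` is contained in a finite substructure all of whose
embeddings into `M` extend to automorphisms. -/
def CofinallyExtending (L : FirstOrder.Language.{0, 0}) (M : Type) [L.Structure M] : Prop :=
  ∀ A : L.Substructure M, (A : Set M).Finite →
    ∃ B : L.Substructure M, (B : Set M).Finite ∧ A ≤ B ∧
      ∀ f : ↥B ↪[L] M, ∃ g : M ≃[L] M, ∀ x : ↥B, g x = f x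

/-- Every finite substructure of `M` is contained in a finite amalgamation base. -/
def CofinalAmalgamationBases (L : FirstOrder.Language.{0, 0}) (M : Type) [L.Structure M] : Prop :=
  ∀ A : L.Substructure M, (A : Set M).Finite →
    ∃ B : L.Substructure M, (B : Set M).Finite ∧ A ≤ B ∧ IsAmalgamationBase L (FinAge L M) ↥B

theorem exists_fin_range_eq {s : Set M} (hs : s.Finite) :
    ∃ (p : ℕ) (a : Fin p → M), Set.range a = s := by
  have := hs.to_subtype
  obtain ⟨p, ⟨e⟩⟩ := Finite.exists_equiv_fin s
  exact ⟨p, fun i => e.symm i, by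
    ext x
    exact ⟨fun ⟨i, hi⟩ => hi ▸ (e.symm i).2, fun hx => ⟨e ⟨x, hx⟩, by simp⟩⟩⟩

theorem BoundedlyHomogenizable.cofinallyExtending [L.IsRelational]
    (h : BoundedlyHomogenizable L M) : CofinallyExtending L M := by
  intro A hA
  obtain ⟨p, a, ha⟩ := exists_fin_range_eq hA
  obtain ⟨q, b, φ, hφ, hab, hiso⟩ := h.2 p a
  set c := Fin.append a b
  let B := Substructure.closure L (Set.range c)
  have hB : (B : Set M) = Set.range c := Substructure.closure_eq_of_isRelational _ _
  refine ⟨B, hB ▸ Set.finite_range c, fun x hx => ?_, fun f => ?_⟩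
  · have hx' : x ∈ Set.range a := ha ▸ hx
    obtain ⟨i, rfl⟩ := hx'
    exact Substructure.subset_closure ⟨Fin.castAdd q i, Fin.append_left a b i⟩
  · let c' : Fin (p + q) → B := fun i => ⟨c i, Substructure.subset_closure ⟨i, rfl⟩⟩
    have hc' : φ.Realize (f ∘ c') :=
      (realize_comp_embedding hφ f c').2 ((realize_comp_embedding hφ B.subtype c').1 hab)
    obtain ⟨g, hg⟩ := (hiso _ hc').exists_equiv h.1
    refine ⟨g, fun x => ?_⟩
    have hx : (x : M) ∈ Set.range c := hB ▸ x.2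
    obtain ⟨i, hi⟩ := hx
    have hxi : c' i = x := Subtype.ext hi
    rw [← hxi]
    exact congrFun hg i

theorem CofinallyExtending.boundedlyHomogenizable [L.IsRelational]
    [Finite (Σ n : ℕ, L.Relations n)] (hhom : Homogenizable L M) (h : CofinallyExtending L M) :
    BoundedlyHomogenizable L M := by
  refine ⟨hhom, fun p a => ?_⟩
  obtain ⟨B, hfin, hAB, hB⟩ := h (Substructure.closure L (Set.range a))
    (by rw [Substructure.closure_eq_of_isRelational]; exact Set.finite_range a)
  obtain ⟨q, b, hb⟩ := exists_fin_range_eq hfin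
  have haB : Set.range a ⊆ B := Substructure.closure_le.1 hAB
  have hrange : (B : Set M) = Set.range (Fin.append a b) := by
    rw [range_append, hb, Set.union_eq_right.2 haB]
  obtain ⟨θ, hθ, hab, hiso⟩ := exists_isQF_atomicEquiv (L := L) (Fin.append a b)
  refine ⟨q, b, θ, hθ, hab, fun c hc => ?_⟩
  obtain ⟨f, hf⟩ := (hiso c hc).exists_embedding B hrange
  obtain ⟨g, hg⟩ := hB f
  have hgc : g ∘ Fin.append a b = c := funext fun i => by
    have hi : Fin.append a b i ∈ B := by
      rw [← SetLike.mem_coe, hrange]; exact ⟨i, rfl⟩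
    exact (hg ⟨_, hi⟩).trans (hf i hi)
  exact hgc ▸ sameType_comp_equiv g _

theorem CofinallyExtending.cofinalAmalgamationBases [L.IsRelational]
    (h : CofinallyExtending L M) : CofinalAmalgamationBases L M := by
  intro A hA
  obtain ⟨B, hfin, hAB, hB⟩ := h A hA
  refine ⟨B, hfin, hAB, ?_⟩
  rintro P Q ⟨hP, ⟨eP⟩⟩ ⟨hQ, ⟨eQ⟩⟩ f g
  obtain ⟨u, hu⟩ := hB (eP.comp f)
  obtain ⟨v, hv⟩ := hB (eQ.comp g)
  let iP : P ↪[L] M := u.symm.toEmbedding.comp eP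
  let iQ : Q ↪[L] M := v.symm.toEmbedding.comp eQ
  let D := Substructure.closure L (Set.range iP ∪ Set.range iQ)
  have hD : (D : Set M).Finite := by
    rw [Substructure.closure_eq_of_isRelational]
    exact (Set.finite_range _).union (Set.finite_range _)
  refine ⟨Bundled.of D, ⟨hD.to_subtype, ⟨D.subtype⟩⟩,
    iP.codRestrict D fun x => Substructure.subset_closure (Or.inl ⟨x, rfl⟩),
    iQ.codRestrict D fun x => Substructure.subset_closure (Or.inr ⟨x, rfl⟩), fun x => ?_⟩
  refine Subtype.ext ?_
  have h1 : iP (f x) = x := u.injective ((u.apply_symm_apply _).trans (hu x).symm)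
  have h2 : iQ (g x) = x := v.injective ((v.apply_symm_apply _).trans (hv x).symm)
  exact h1.trans h2.symm

end Extension

section ModelCompleteness

variable {L : FirstOrder.Language.{0, 0}} {M : Type} [L.Structure M]

theorem realize_of_forall_realize {N : Type} [L.Structure N] [N ⊨ L.completeTheory M] {p : ℕ}
    {φ : L.Formula (Fin p)} (h : ∀ v : Fin p → M, φ.Realize v) (v : Fin p → N) : φ.Realize v := by
  let ψ : L.Sentence := (φ.relabel (Sum.inr : Fin p → Empty ⊕ Fin p)).iAlls (Fin p)
  have hψ : M ⊨ ψ := by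
    simp only [ψ, Sentence.Realize, Formula.realize_iAlls, Formula.realize_relabel]
    exact fun w => h w
  have hN := (realize_iff_of_model_completeTheory M N ψ).2 hψ
  simp only [ψ, Sentence.Realize, Formula.realize_iAlls, Formula.realize_relabel] at hN
  exact hN v

/-- Embeddings between models of the theory of a boundedly homogenizable structure preserve
all formulas. -/
theorem BoundedlyHomogenizable.realize_of_realize [L.IsRelational]
    [Finite (Σ n : ℕ, L.Relations n)] (h : BoundedlyHomogenizable L M) {N P : Type}
    [L.Structure N] [L.Structure P] [N ⊨ L.completeTheory M] [P ⊨ L.completeTheory M]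
    (f : N ↪[L] P) {p : ℕ} {φ : L.Formula (Fin p)} {x : Fin p → N} (hx : φ.Realize x) :
    φ.Realize (f ∘ x) := by
  obtain ⟨X, _, T, hT⟩ := h.1.exists_finite_invariant_sameType p
  let Y := {y : X // ∃ a, T a = y ∧ φ.Realize a}
  have hex : ∀ y : Y, ∃ (a : Fin p → M) (q : ℕ) (b : Fin q → M) (ψ : L.Formula (Fin (p + q))),
      T a = y ∧ φ.Realize a ∧ ψ.IsQF ∧ ψ.Realize (Fin.append a b) ∧
        ∀ c, ψ.Realize c → SameType L M (Fin.append a b) c := by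
    rintro ⟨y, a, hay, ha⟩
    obtain ⟨q, b, ψ, h1, h2, h3⟩ := h.2 p a
    exact ⟨a, q, b, ψ, hay, ha, h1, h2, h3⟩
  choose a q b ψ hay ha hqf hψ hiso using hex
  let χ : ∀ y : Y, L.Formula (Fin p) := fun y =>
    ((ψ y).relabel finSumFinEquiv.symm).iExs (Fin (q y))
  have hχ : ∀ {R : Type} [L.Structure R] (y : Y) (v : Fin p → R),
      (χ y).Realize v ↔ ∃ w : Fin (q y) → R, (ψ y).Realize (Fin.append v w) := by
    intro R _ y v
    have happ : ∀ w : Fin (q y) → R, Sum.elim v w ∘ finSumFinEquiv.symm = Fin.append v w :=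
      fun w => funext fun i => by
        induction i using Fin.addCases <;> simp
    simp only [χ, Formula.realize_iExs, Formula.realize_relabel]
    exact exists_congr fun w => by rw [← happ w]
  have hcover : ∀ v : Fin p → M, (φ.imp (Formula.iSup χ)).Realize v := by
    intro v
    rw [Formula.realize_imp, Formula.realize_iSup]
    intro hv
    let y : Y := ⟨T v, v, rfl, hv⟩
    obtain ⟨g, hg⟩ := (hT (a y) v (hay y)).exists_equiv h.1
    refine ⟨y, (hχ y v).2 ⟨g ∘ b y, ?_⟩⟩
    have := (sameType_comp_equiv g (Fin.append (a y) (b y)) (ψ y)).1 (hψ y)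
    rwa [comp_append, hg] at this
  have hsound : ∀ (y : Y) (v : Fin p → M), ((χ y).imp φ).Realize v := by
    intro y v
    rw [Formula.realize_imp, hχ]
    rintro ⟨w, hw⟩
    have := (hiso y _ hw (φ.relabel (Fin.castAdd (q y)))).1 (by
      simpa [Function.comp_def] using ha y)
    simpa [Function.comp_def] using this
  obtain ⟨y, hy⟩ := Formula.realize_iSup.1
    (Formula.realize_imp.1 (realize_of_forall_realize hcover x) hx)
  obtain ⟨w, hw⟩ := (hχ y x).1 hy
  refine Formula.realize_imp.1 (realize_of_forall_realize (hsound y) (f ∘ x))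
    ((hχ y _).2 ⟨f ∘ w, ?_⟩)
  rw [← comp_append]
  exact (realize_comp_embedding (hqf y) f _).2 hw

theorem BoundedlyHomogenizable.modelComplete [L.IsRelational]
    [Finite (Σ n : ℕ, L.Relations n)] (h : BoundedlyHomogenizable L M) : ModelComplete L M := by
  intro N P f p φ x
  refine ⟨fun hf => ?_, fun hx => h.realize_of_realize f hx⟩
  by_contra hx
  exact Formula.realize_not.1 (h.realize_of_realize f (Formula.realize_not.2 hx)) hf

end ModelCompleteness

section Ultrapower

variable {L : FirstOrder.Language.{0, 0}} {M : Type} [L.Structure M]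

/-- An ultrafilter on the finite subsets of `M` containing every cone `{s | t ⊆ s}`. -/
noncomputable def coneUltrafilter (M : Type) : Ultrafilter (Finset M) :=
  Ultrafilter.of Filter.atTop

/-- The ultrapower of `M` along `coneUltrafilter M`. -/
abbrev ConePower (M : Type) : Type :=
  (coneUltrafilter M : Filter (Finset M)).Product fun _ => M

theorem eventually_subset (t : Finset M) : ∀ᶠ s in (coneUltrafilter M : Filter (Finset M)), t ⊆ s :=
  Ultrafilter.of_le _ (Filter.eventually_ge_atTop t)

instance [Nonempty M] : ConePower M ⊨ L.completeTheory M :=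
  ⟨fun φ hφ => (Ultraproduct.sentence_realize φ).2 (Filter.Eventually.of_forall fun _ => hφ)⟩

open Classical in
/-- A family of partial maps of `M` induces a map of `M` into its ultrapower. -/
noncomputable def toConePower (C : Finset M → L.Substructure M) (e : ∀ s, C s ↪[L] M) (m : M) :
    ConePower M :=
  Quotient.mk _ fun s => if h : m ∈ C s then e s ⟨m, h⟩ else m

theorem exists_embedding_conePower [L.IsRelational] (C : Finset M → L.Substructure M)
    (hC : ∀ s : Finset M, (s : Set M) ⊆ C s) (e : ∀ s, C s ↪[L] M) :
    ∃ E : M ↪[L] ConePower M, ∀ m, E m = toConePower C e m := by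
  classical
  refine ⟨⟨⟨toConePower C e, fun m m' hmm => ?_⟩, fun f => isEmptyElim f, fun {n} r x => ?_⟩,
    fun m => rfl⟩
  · have hev : ∀ᶠ s in (coneUltrafilter M : Filter (Finset M)),
        (if h : m ∈ C s then e s ⟨m, h⟩ else m) = if h : m' ∈ C s then e s ⟨m', h⟩ else m' :=
      Quotient.exact hmm
    obtain ⟨s, hs, hsub⟩ := (hev.and (eventually_subset {m, m'})).exists
    have hm : m ∈ C s := hC s (hsub (by simp))
    have hm' : m' ∈ C s := hC s (hsub (by simp))
    rw [dif_pos hm, dif_pos hm'] at hs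
    exact congrArg Subtype.val ((e s).injective hs)
  · have hloc : ∀ᶠ s in (coneUltrafilter M : Filter (Finset M)),
        (Structure.RelMap r (fun i => if h : x i ∈ C s then e s ⟨x i, h⟩ else x i) ↔
          Structure.RelMap r x) := by
      filter_upwards [eventually_subset (Finset.univ.image x)] with s hs
      have hx : ∀ i, x i ∈ C s := fun i =>
        hC s (hs (Finset.mem_image_of_mem x (Finset.mem_univ i)))
      simp only [hx, dif_pos]
      exact (e s).map_rel r fun i => ⟨x i, hx i⟩
    refine (relMap_quotient_mk' _ r _).trans ((Filter.eventually_congr hloc).trans ?_)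
    exact Filter.eventually_const

/-- In a model-complete structure, embeddings of finite amalgamation bases preserve types. -/
theorem ModelComplete.sameType_of_isAmalgamationBase [L.IsRelational] [Nonempty M]
    (hmc : ModelComplete L M) {B : L.Substructure M} (hfin : (B : Set M).Finite)
    (hB : IsAmalgamationBase L (FinAge L M) ↥B) (f : B ↪[L] M) {p : ℕ} (b : Fin p → B) :
    SameType L M (fun i => b i) (f ∘ b) := by
  have := hfin.to_subtype
  let C : Finset M → L.Substructure M := fun s => Substructure.closure L (s ∪ B)
  let C' : Finset M → L.Substructure M := fun s => Substructure.closure L (s ∪ Set.range f)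
  have hBC : ∀ s, B ≤ C s := fun s x hx => Substructure.subset_closure (Or.inr hx)
  have hfC : ∀ s x, f x ∈ C' s := fun s x => Substructure.subset_closure (Or.inr ⟨x, rfl⟩)
  have hfinC : ∀ s, Finite (C s) := fun s => by
    have : (C s : Set M).Finite := by
      rw [Substructure.closure_eq_of_isRelational]; exact s.finite_toSet.union hfin
    exact this.to_subtype
  have hfinC' : ∀ s, Finite (C' s) := fun s => by
    have : (C' s : Set M).Finite := by
      rw [Substructure.closure_eq_of_isRelational]; exact s.finite_toSet.union (Set.finite_range f)
    exact this.to_subtype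
  have hamalg : ∀ s, ∃ (e : C s ↪[L] M) (e' : C' s ↪[L] M),
      ∀ x : B, e ⟨x, hBC s x.2⟩ = e' ⟨f x, hfC s x⟩ := fun s => by
    obtain ⟨D, ⟨-, ⟨d⟩⟩, i, j, hij⟩ := hB (Bundled.of (C s)) (Bundled.of (C' s))
      ⟨hfinC s, ⟨(C s).subtype⟩⟩ ⟨hfinC' s, ⟨(C' s).subtype⟩⟩
      (Substructure.inclusion (hBC s)) (f.codRestrict (C' s) (hfC s))
    exact ⟨d.comp i, d.comp j, fun x => congrArg d (hij x)⟩
  choose e e' hee using hamalg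
  obtain ⟨E, hE⟩ := exists_embedding_conePower C
    (fun s x hx => Substructure.subset_closure (Or.inl hx)) e
  obtain ⟨E', hE'⟩ := exists_embedding_conePower C'
    (fun s x hx => Substructure.subset_closure (Or.inl hx)) e'
  have hEE : ∀ x : B, E x = E' (f x) := fun x => by
    rw [hE, hE']
    refine congrArg (Quotient.mk _) (funext fun s => ?_)
    rw [dif_pos (hBC s x.2), dif_pos (hfC s x)]
    exact hee s x
  let N₁ := Theory.ModelType.of (L.completeTheory M) M
  let N₂ := Theory.ModelType.of (L.completeTheory M) (ConePower M)
  intro φ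
  have h1 : φ.Realize (fun i => E (b i)) ↔ φ.Realize fun i => (b i : M) :=
    hmc N₁ N₂ E p φ fun i => (b i : M)
  have h2 : φ.Realize (fun i => E' (f (b i))) ↔ φ.Realize (f ∘ b) :=
    hmc N₁ N₂ E' p φ (f ∘ b)
  simp only [hEE] at h1
  exact h1.symm.trans h2

theorem ModelComplete.cofinallyExtending [L.IsRelational] [Nonempty M]
    (hhom : Homogenizable L M) (hmc : ModelComplete L M) (h : CofinalAmalgamationBases L M) :
    CofinallyExtending L M := by
  intro A hA
  obtain ⟨B, hfin, hAB, hB⟩ := h A hA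
  refine ⟨B, hfin, hAB, fun f => ?_⟩
  have := hfin.to_subtype
  obtain ⟨p, ⟨b⟩⟩ := Finite.exists_equiv_fin B
  obtain ⟨g, hg⟩ := (hmc.sameType_of_isAmalgamationBase hfin hB f b.symm).exists_equiv hhom
  refine ⟨g, fun x => ?_⟩
  simpa using congrFun hg (b x)

end Ultrapower

/-- Characterizations of boundedly homogenizable structures. -/
theorem boundedlyHomogenizable_tfae
    (L : FirstOrder.Language.{0, 0}) [L.IsRelational] [Finite (Σ n : ℕ, L.Relations n)]
    (M : Type) [L.Structure M] [Countable M] [Infinite M]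
    (hhom : Homogenizable L M) :
    (BoundedlyHomogenizable L M ↔
      ∀ A : L.Substructure M, (A : Set M).Finite →
        ∃ B : L.Substructure M, (B : Set M).Finite ∧ A ≤ B ∧
          ∀ f : ↥B ↪[L] M, ∃ g : M ≃[L] M, ∀ x : ↥B, g x = f x) ∧
    (BoundedlyHomogenizable L M ↔
      (ModelComplete L M ∧
        ∀ A : L.Substructure M, (A : Set M).Finite →
          ∃ B : L.Substructure M, (B : Set M).Finite ∧ A ≤ B ∧
            IsAmalgamationBase L (FinAge L M) ↥B)) := by
  refine ⟨⟨fun h => h.cofinallyExtending, fun h => ?_⟩,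
    ⟨fun h => ⟨h.modelComplete, h.cofinallyExtending.cofinalAmalgamationBases⟩, fun h => ?_⟩⟩
  · exact CofinallyExtending.boundedlyHomogenizable hhom h
  · exact (h.1.cofinallyExtending hhom h.2).boundedlyHomogenizable hhom

end HomPaper
end

section
/- If a structure M over a finite relational vocabulary is boundedly homogenizable, then M is Σ1-homogenizable and Th(M) is model-complete. -/
open FirstOrder FirstOrder.Language CategoryTheory

namespace HomPaper

open Structure

instance inst_s8 (n : ℕ) (k : Fin n → ℕ) : (expLang n k).IsRelational :=
  fun _ => inferInstanceAs (IsEmpty Empty)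

instance (n : ℕ) (k : Fin n → ℕ) : Finite (Σ m : ℕ, (expLang n k).Relations m) :=
  Finite.of_surjective (fun i : Fin n => (⟨k i, i, rfl⟩ : Σ m : ℕ, (expLang n k).Relations m))
    (by rintro ⟨_, i, rfl⟩; exact ⟨i, rfl⟩)

instance {L L' : FirstOrder.Language.{0, 0}} [Finite (Σ m : ℕ, L.Relations m)]
    [Finite (Σ m : ℕ, L'.Relations m)] : Finite (Σ m : ℕ, (L.sum L').Relations m) :=
  Finite.of_equiv _ (Equiv.sigmaSumDistrib L.Relations L'.Relations).symm

/-- In an ultrahomogeneous relational structure, two finite families with the same atomic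
diagram are conjugate under an automorphism. -/
theorem _root_.FirstOrder.Language.IsUltrahomogeneous.exists_equiv_of_relMap_iff
    {L : FirstOrder.Language.{0, 0}} [L.IsRelational] {M : Type} [L.Structure M]
    (hM : L.IsUltrahomogeneous M) {ι : Type} [Finite ι] (a b : ι → M)
    (heq : ∀ i j, a i = a j ↔ b i = b j)
    (hrel : ∀ (n : ℕ) (r : L.Relations n) (t : Fin n → ι),
      RelMap r (a ∘ t) ↔ RelMap r (b ∘ t)) :
    ∃ g : M ≃[L] M, ∀ i, g (a i) = b i := by
  let S : L.Substructure M := Substructure.closure L (Set.range a)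
  have hS : ∀ x : S, ∃ i, a i = x := fun x =>
    (Substructure.mem_closure_iff_of_isRelational L (Set.range a) (x : M)).1 x.2
  choose c hc using hS
  let f : S ↪[L] M :=
    { toFun := fun x => b (c x)
      inj' := fun x y hxy => Subtype.ext (by rw [← hc x, ← hc y]; exact (heq _ _).2 hxy)
      map_fun' := fun f => isEmptyElim f
      map_rel' := fun {n} r x => by
        have hx : (fun i => (x i : M)) = a ∘ (fun i => c (x i)) := funext fun i => (hc (x i)).symm
        change RelMap r (b ∘ fun i => c (x i)) ↔ RelMap r (fun i => (x i : M))
        rw [hx]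
        exact (hrel n r _).symm }
  obtain ⟨g, hg⟩ := hM S (Substructure.fg_closure (Set.finite_range a)) f
  refine ⟨g, fun i => ?_⟩
  have hi : a i ∈ S := Substructure.subset_closure ⟨i, rfl⟩
  have hgi : f ⟨a i, hi⟩ = g (a i) := by rw [hg]; rfl
  rw [← hgi]
  exact (heq _ _).1 (hc ⟨a i, hi⟩)

/-- A homogenizable structure over a finite relational language realizes only finitely many
complete types of each arity. -/
theorem Homogenizable.exists_finite_representatives {L : FirstOrder.Language.{0, 0}}
    [L.IsRelational] [Finite (Σ n : ℕ, L.Relations n)] {M : Type} [L.Structure M]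
    (hM : Homogenizable L M) (p : ℕ) :
    ∃ (ι : Type) (_ : Finite ι) (t : ι → Fin p → M), ∀ a, ∃ i, SameType L M (t i) a := by
  obtain ⟨n, k, φ, hφ⟩ := hM
  let _ : (expLang n k).Structure M := expStructure L M φ
  replace hφ : (L.sum (expLang n k)).IsUltrahomogeneous M := hφ
  let diagram (a : Fin p → M) : (Fin p × Fin p → Prop) ×
      ((Σ r : (Σ m : ℕ, (L.sum (expLang n k)).Relations m), Fin r.1 → Fin p) → Prop) :=
    (fun ij => a ij.1 = a ij.2, fun r => RelMap r.1.2 (a ∘ r.2))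
  refine ⟨Set.range diagram, inferInstance, fun d => d.2.choose, fun a =>
    ⟨⟨diagram a, a, rfl⟩, ?_⟩⟩
  have hd := (⟨a, rfl⟩ : diagram a ∈ Set.range diagram).choose_spec
  change SameType L M (Exists.choose _) a
  generalize Exists.choose _ = a' at hd ⊢
  obtain ⟨g, hg⟩ := hφ.exists_equiv_of_relMap_iff a' a
    (fun i j => iff_of_eq (congrFun (congrArg Prod.fst hd) (i, j)))
    (fun m r t => iff_of_eq (congrFun (congrArg Prod.snd hd) ⟨⟨m, r⟩, t⟩))
  intro ψ
  have key := StrongHomClass.realize_formula g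
    ((LHom.sumInl : L →ᴸ L.sum (expLang n k)).onFormula ψ) (v := a')
  rw [LHom.realize_onFormula, LHom.realize_onFormula, show g ∘ a' = a from funext hg] at key
  exact key.symm

/-- A family of formulas isolating all types of the arities of a homogenizing family is itself
homogenizing. -/
theorem Homogenizes.of_isolating {L : FirstOrder.Language.{0, 0}} [L.IsRelational]
    {M : Type} [L.Structure M] {n : ℕ} {k : Fin n → ℕ}
    {φ : ∀ i : Fin n, L.Formula (Fin (k i))} (hφ : Homogenizes L M φ)
    {m : ℕ} {l : Fin m → ℕ} (ψ : ∀ j : Fin m, L.Formula (Fin (l j)))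
    (hψ : ∀ i (a : Fin (k i) → M), ∃ (j : Fin m) (h : l j = k i),
      (ψ j).Realize (a ∘ Fin.cast h) ∧
        ∀ b : Fin (k i) → M, (ψ j).Realize (b ∘ Fin.cast h) → SameType L M a b) :
    Homogenizes L M ψ := by
  let _ : (expLang n k).Structure M := expStructure L M φ
  let _ : (expLang m l).Structure M := expStructure L M ψ
  replace hφ : (L.sum (expLang n k)).IsUltrahomogeneous M := hφ
  change (L.sum (expLang m l)).IsUltrahomogeneous M
  intro S hS f
  have : Finite S := by
    obtain ⟨s, rfl⟩ := hS
    refine Set.Finite.to_subtype (s := (Substructure.closure (L.sum (expLang m l)) (s : Set M) :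
      Set M)) ?_
    rw [Substructure.closure_eq_of_isRelational]
    exact s.finite_toSet
  have hrel : ∀ (q : ℕ) (r : (L.sum (expLang n k)).Relations q) (t : Fin q → S),
      RelMap r ((Subtype.val : S → M) ∘ t) ↔ RelMap r (f ∘ t) := by
    rintro q (r | ⟨i, rfl⟩) t
    · exact (f.map_rel (Sum.inl r : (L.sum (expLang m l)).Relations q) t).symm
    · obtain ⟨j, h, hj, hiso⟩ := hψ i (Subtype.val ∘ t)
      have hfj := (f.map_rel (Sum.inr ⟨j, h⟩ : (L.sum (expLang m l)).Relations (k i)) t).2 hj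
      exact hiso (f ∘ t) hfj (φ i)
  obtain ⟨g, hg⟩ := hφ.exists_equiv_of_relMap_iff (Subtype.val : S → M) f
    (fun i j => by rw [f.injective.eq_iff, Subtype.ext_iff]) hrel
  have hgL : ∀ {p : ℕ} (χ : L.Formula (Fin p)) (v : Fin p → M),
      χ.Realize (g ∘ v) ↔ χ.Realize v := fun χ v => by
    have key := StrongHomClass.realize_formula g
      ((LHom.sumInl : L →ᴸ L.sum (expLang n k)).onFormula χ) (v := v)
    rwa [LHom.realize_onFormula, LHom.realize_onFormula] at key
  let g' : M ≃[L.sum (expLang m l)] M :=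
    { toEquiv := g.toEquiv
      map_fun' := fun f => isEmptyElim f
      map_rel' := by
        rintro q (r | ⟨j, rfl⟩) x
        · exact g.map_rel (Sum.inl r : (L.sum (expLang n k)).Relations q) x
        · exact hgL (ψ j) x }
  exact ⟨g', Embedding.ext fun x => (hg x).symm⟩

theorem IsSigma1.realize_embedding {L : FirstOrder.Language.{0, 0}} {α : Type}
    {φ : L.Formula α} (hφ : IsSigma1 L φ) {N N' : Type*} [L.Structure N] [L.Structure N']
    (f : N ↪[L] N') {v : α → N} (hv : φ.Realize v) : φ.Realize (f ∘ v) := by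
  obtain ⟨m, ψ, hψ, rfl⟩ := hφ
  obtain ⟨xs, hxs⟩ := BoundedFormula.realize_exs.1 hv
  exact BoundedFormula.realize_exs.2 ⟨f ∘ xs, (hψ.realize_embedding f).2 hxs⟩

/-- In a boundedly homogenizable structure, every complete type is isolated by a
`Σ₁`-formula. -/
theorem BoundedlyHomogenizable.exists_sigma1_isolating {L : FirstOrder.Language.{0, 0}}
    {M : Type} [L.Structure M] (hM : BoundedlyHomogenizable L M) {p : ℕ} (a : Fin p → M) :
    ∃ σ : L.Formula (Fin p), IsSigma1 L σ ∧ σ.Realize a ∧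
      ∀ c, σ.Realize c → SameType L M a c := by
  obtain ⟨q, b, θ, hθ, hab, hiso⟩ := hM.2 p a
  let ψ : L.BoundedFormula (Fin p) q := BoundedFormula.relabel finSumFinEquiv.symm θ
  have hreal : ∀ (c : Fin p → M) (d : Fin q → M),
      ψ.Realize c d ↔ θ.Realize (Fin.append c d) := fun c d => by
    refine BoundedFormula.realize_relabel.trans ?_
    have hv : (Sum.elim c (d ∘ Fin.castAdd 0) ∘ finSumFinEquiv.symm : Fin (p + q) → M) =
        Fin.append c d := by
      funext i
      refine Fin.addCases (fun i => ?_) (fun i => ?_) i <;> simp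
    rw [hv, Formula.Realize]
    exact iff_of_eq (congrArg _ (Subsingleton.elim _ _))
  refine ⟨ψ.exs, ⟨q, ψ, hθ.relabel _, rfl⟩, BoundedFormula.realize_exs.2 ⟨b, (hreal a b).2 hab⟩,
    fun c hc χ => ?_⟩
  obtain ⟨d, hd⟩ := BoundedFormula.realize_exs.1 hc
  have key := hiso _ ((hreal c d).1 hd) (χ.relabel (Fin.castAdd q))
  have happ : ∀ (u : Fin p → M) (w : Fin q → M), Fin.append u w ∘ Fin.castAdd q = u :=
    fun u w => funext fun i => Fin.append_left u w i
  rwa [Formula.realize_relabel, Formula.realize_relabel, happ, happ] at key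

/-- In a boundedly homogenizable structure over a finite relational language, all complete types
of a given arity are isolated by finitely many `Σ₁`-formulas. -/
theorem BoundedlyHomogenizable.exists_finite_sigma1_isolating {L : FirstOrder.Language.{0, 0}}
    [L.IsRelational] [Finite (Σ n : ℕ, L.Relations n)] {M : Type} [L.Structure M]
    (hM : BoundedlyHomogenizable L M) (p : ℕ) :
    ∃ (ι : Type) (_ : Finite ι) (σ : ι → L.Formula (Fin p)), (∀ i, IsSigma1 L (σ i)) ∧
      ∀ a, ∃ i, (σ i).Realize a ∧ ∀ c, (σ i).Realize c → SameType L M a c := by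
  obtain ⟨ι, hι, t, ht⟩ := hM.1.exists_finite_representatives p
  choose σ hσ hσt hiso using fun i => hM.exists_sigma1_isolating (t i)
  refine ⟨ι, hι, σ, hσ, fun a => ?_⟩
  obtain ⟨i, hi⟩ := ht a
  exact ⟨i, (hi (σ i)).1 (hσt i), fun c hc χ => (hi χ).symm.trans (hiso i c hc χ)⟩

theorem BoundedlyHomogenizable.sigma1Homogenizable {L : FirstOrder.Language.{0, 0}}
    [L.IsRelational] [Finite (Σ n : ℕ, L.Relations n)] {M : Type} [L.Structure M]
    (hM : BoundedlyHomogenizable L M) : Sigma1Homogenizable L M := by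
  obtain ⟨n, k, φ, hφ⟩ := hM.1
  choose ι hι σ hσ hiso using fun i => hM.exists_finite_sigma1_isolating (k i)
  obtain ⟨m, ⟨e⟩⟩ := Finite.exists_equiv_fin (Σ i, ι i)
  refine ⟨m, fun j => k (e.symm j).1, fun j => σ _ (e.symm j).2, fun j => hσ _ _,
    hφ.of_isolating _ fun i a => ?_⟩
  obtain ⟨j, hj⟩ := hiso i a
  obtain ⟨x, hx⟩ : ∃ x, e.symm x = ⟨i, j⟩ := e.symm.surjective _
  refine ⟨x, by rw [hx], ?_⟩
  generalize_proofs h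
  revert h
  rw [hx]
  exact fun _ => hj

/-- Two formulas equivalent in `M` are equivalent in every model of the theory of `M`. -/
theorem realize_iff_of_model_completeTheory {L : FirstOrder.Language.{0, 0}} {M : Type}
    [L.Structure M] {p : ℕ} {φ ψ : L.Formula (Fin p)}
    (hM : ∀ v : Fin p → M, φ.Realize v ↔ ψ.Realize v)
    {N : Type*} [L.Structure N] [N ⊨ L.completeTheory M] (v : Fin p → N) :
    φ.Realize v ↔ ψ.Realize v := by
  let χ : L.BoundedFormula Empty p := BoundedFormula.relabel Sum.inr (φ.iff ψ)
  have hχ : M ⊨ (χ.alls : L.Sentence) := BoundedFormula.realize_alls.2 fun v =>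
    (Formula.realize_relabel_sumInr _).2 (Formula.realize_iff.2 (hM v))
  have hN : N ⊨ (χ.alls : L.Sentence) :=
    (FirstOrder.Language.realize_iff_of_model_completeTheory M N _).2 hχ
  exact Formula.realize_iff.1
    ((Formula.realize_relabel_sumInr _).1 (BoundedFormula.realize_alls.1 hN v))

theorem BoundedlyHomogenizable.realize_of_embedding {L : FirstOrder.Language.{0, 0}}
    [L.IsRelational] [Finite (Σ n : ℕ, L.Relations n)] {M : Type} [L.Structure M]
    (hM : BoundedlyHomogenizable L M) {N₁ N₂ : Type*} [L.Structure N₁] [L.Structure N₂]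
    [N₁ ⊨ L.completeTheory M] [N₂ ⊨ L.completeTheory M] (f : N₁ ↪[L] N₂) {p : ℕ}
    (φ : L.Formula (Fin p)) {x : Fin p → N₁} (hx : φ.Realize x) : φ.Realize (f ∘ x) := by
  obtain ⟨ι, hι, σ, hσ, hiso⟩ := hM.exists_finite_sigma1_isolating p
  let J := {i : ι // ∀ a : Fin p → M, (σ i).Realize a → φ.Realize a}
  have hφ : ∀ v : Fin p → M,
      φ.Realize v ↔ (Formula.iSup fun i : J => σ i.1).Realize v := fun v => by
    rw [Formula.realize_iSup]
    refine ⟨fun hv => ?_, fun ⟨i, hi⟩ => i.2 v hi⟩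
    obtain ⟨i, hi, hsame⟩ := hiso v
    exact ⟨⟨i, fun c hc => (hsame c hc φ).1 hv⟩, hi⟩
  rw [realize_iff_of_model_completeTheory hφ, Formula.realize_iSup] at hx ⊢
  exact hx.imp fun i hi => (hσ i.1).realize_embedding f hi

end HomPaper

namespace HomPaper

/-- A boundedly homogenizable structure is `Σ₁`-homogenizable and
model-complete. -/
theorem boundedlyHomogenizable_sigma1_modelComplete
    (L : FirstOrder.Language.{0, 0}) [L.IsRelational] [Finite (Σ n : ℕ, L.Relations n)]
    (M : Type) [L.Structure M]
    (h : BoundedlyHomogenizable L M) :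
    Sigma1Homogenizable L M ∧ ModelComplete L M := by
  refine ⟨h.sigma1Homogenizable, fun N₁ N₂ f p φ x => ⟨fun hx => ?_, h.realize_of_embedding f φ⟩⟩
  by_contra hn
  exact (Formula.realize_not.1 (h.realize_of_embedding f φ.not (Formula.realize_not.2 hn))) hx

end HomPaper
end

section
/- If M is a uniformly homogenizable structure over a finite relational vocabulary, then M may be homogenized using only uniformly homogenizing formulas. -/
open FirstOrder FirstOrder.Language CategoryTheory

namespace HomPaper

open FirstOrder.Language.BoundedFormula

/-- The atomic diagram of a tuple: the equalities and the relations that hold among its entries. -/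
def atomicDiagram (L : FirstOrder.Language.{0, 0}) (M : Type) [L.Structure M] {β : Type}
    (u : β → M) :
    Set (β × β) × Set (Σ r : (Σ n : ℕ, L.Relations n), Fin r.1 → β) :=
  ({x | u x.1 = u x.2}, {x | Structure.RelMap x.1.2 (u ∘ x.2)})

lemma exists_eq_var {L : FirstOrder.Language.{0, 0}} [L.IsRelational] {β : Type}
    (t : L.Term β) : ∃ x, t = Term.var x := by
  cases t with
  | var x => exact ⟨x, rfl⟩
  | func f _ => exact isEmptyElim f

/-- In a relational language, tuples with the same atomic diagram satisfy the same
quantifier-free formulas. -/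
lemma realize_iff_of_atomicDiagram_eq {L : FirstOrder.Language.{0, 0}} [L.IsRelational]
    {M : Type} [L.Structure M] {α : Type} {n : ℕ} {φ : L.BoundedFormula α n} (hφ : φ.IsQF)
    {v v' : α → M} {xs xs' : Fin n → M}
    (h : atomicDiagram L M (Sum.elim v xs) = atomicDiagram L M (Sum.elim v' xs')) :
    φ.Realize v xs ↔ φ.Realize v' xs' := by
  induction hφ with
  | falsum => rfl
  | imp _ _ h₁ h₂ => rw [realize_imp, realize_imp, h₁, h₂]
  | of_isAtomic hat =>
    cases hat with
    | equal t₁ t₂ =>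
      obtain ⟨x, rfl⟩ := exists_eq_var t₁
      obtain ⟨y, rfl⟩ := exists_eq_var t₂
      rw [realize_bdEqual, realize_bdEqual]
      exact Set.ext_iff.1 (congrArg Prod.fst h) (x, y)
    | rel R ts =>
      choose x hx using fun i => exists_eq_var (ts i)
      obtain rfl : ts = fun i => Term.var (x i) := funext hx
      rw [realize_rel, realize_rel]
      exact Set.ext_iff.1 (congrArg Prod.snd h) ⟨⟨_, R⟩, x⟩

lemma isQF_iSup {L : FirstOrder.Language.{0, 0}} {α β : Type} [Finite β] {n : ℕ}
    {f : β → L.BoundedFormula α n} (hf : ∀ b, (f b).IsQF) :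
    (BoundedFormula.iSup f).IsQF := by
  simp only [BoundedFormula.iSup]
  generalize (@Finset.univ β (Fintype.ofFinite β)).toList = l
  induction l with
  | nil => exact isQF_bot
  | cons b l ih => exact (hf b).sup ih

/-- If the type of every tuple extending `a` is isolated by a quantifier-free formula, then
every formula `φ` is defined by a quantifier-free formula with parameters `a`, which moreover
implies `φ` for every choice of the parameters. -/
lemma exists_isQF_realize_iff {L : FirstOrder.Language.{0, 0}} [L.IsRelational]
    [Finite (Σ n : ℕ, L.Relations n)] {M : Type} [L.Structure M] {p k : ℕ} {a : Fin p → M}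
    (ha : ∀ b : Fin k → M, QFIsolated L M (Fin.append a b)) (φ : L.Formula (Fin k)) :
    ∃ ψ : L.BoundedFormula (Fin k) p, ψ.IsQF ∧
      (∀ (y : Fin k → M) (w : Fin p → M), ψ.Realize y w → φ.Realize y) ∧
      ∀ y : Fin k → M, φ.Realize y → ψ.Realize y a := by
  choose θ hQF hself hiso using ha
  let diag (b : Fin k → M) :=
    atomicDiagram L M (Sum.elim (Fin.append a b) (default : Fin 0 → M))
  let D := {d // ∃ b, φ.Realize b ∧ diag b = d}
  choose b hb hdiag using fun d : D => d.2
  let g : Fin (p + k) → Fin k ⊕ Fin p := Fin.append Sum.inr Sum.inl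
  have hg (y : Fin k → M) (w : Fin p → M) : Sum.elim y w ∘ g = Fin.append w y := by
    funext i
    refine Fin.addCases (fun i => ?_) (fun i => ?_) i <;> simp [g]
  have hreal (b y : Fin k → M) (w : Fin p → M) :
      (BoundedFormula.relabel g (θ b)).Realize y w ↔ (θ b).Realize (Fin.append w y) := by
    rw [realize_relabel, Formula.Realize, ← hg]
    exact iff_of_eq (congrArg _ (Subsingleton.elim _ _))
  refine ⟨BoundedFormula.iSup fun d : D => BoundedFormula.relabel g (θ (b d)),
    isQF_iSup fun d => (hQF _).relabel g, fun y w h => ?_, fun y hy => ?_⟩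
  · obtain ⟨d, hd⟩ := realize_iSup.1 h
    have := hiso _ _ ((hreal _ _ _).1 hd) (φ.relabel (Fin.natAdd p))
    rw [Formula.realize_relabel, Formula.realize_relabel] at this
    simpa [Function.comp_def] using this.1 (by simpa [Function.comp_def] using hb d)
  · refine realize_iSup.2 ⟨⟨diag y, y, hy, rfl⟩, (hreal _ _ _).2 ?_⟩
    exact (realize_iff_of_atomicDiagram_eq (hQF _) (hdiag ⟨diag y, y, hy, rfl⟩)).1 (hself _)

/-- Whether a family of formulas homogenizes `M` depends only on the sets they define. -/
lemma Homogenizes.congr {L : FirstOrder.Language.{0, 0}} {M : Type} [L.Structure M] {n : ℕ}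
    {k : Fin n → ℕ} {φ φ' : ∀ i : Fin n, L.Formula (Fin (k i))} (h : Homogenizes L M φ)
    (hφ : ∀ i (y : Fin (k i) → M), (φ i).Realize y ↔ (φ' i).Realize y) : Homogenizes L M φ' := by
  have : expStructure L M φ = expStructure L M φ' := by
    unfold expStructure
    congr 1
    funext m r x
    exact propext (hφ _ _)
  unfold Homogenizes at h ⊢
  rwa [← this]

/-- A uniformly homogenizable structure may be homogenized using only
uniformly homogenizing formulas. -/
theorem uniformlyHomogenizable_uniformFormulas
    (L : FirstOrder.Language.{0, 0}) [L.IsRelational] [Finite (Σ n : ℕ, L.Relations n)]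
    (M : Type) [L.Structure M]
    (h : UniformlyHomogenizable L M) :
    HasUniformlyHomogenizingFormulas L M := by
  obtain ⟨⟨n, k, φ, hφ⟩, p, a, ha⟩ := h
  choose ψ hQF hsound hcomplete using fun i => exists_isQF_realize_iff (ha (k i)) (φ i)
  refine ⟨n, k, fun _ => p, ψ, hQF, hφ.congr fun i y => ?_, fun i => ⟨a, fun y => ?_⟩⟩
  · rw [realize_exs]
    exact ⟨fun h => ⟨a, hcomplete i y h⟩, fun ⟨w, hw⟩ => hsound i y w hw⟩
  · exact fun ⟨w, hw⟩ => hcomplete i y (hsound i y w hw)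

end HomPaper
end

section
/- If M is a Σ1-homogenizable structure over a finite relational vocabulary such that all of the homogenizing formulas are algebraic (each is satisfied by only finitely many tuples of M), then M is uniformly homogenizable. -/
open FirstOrder FirstOrder.Language CategoryTheory

namespace HomPaper

/-- The tuples `c` and `d` satisfy the same equalities and the same relations of `L`. -/
def SameAtomic (L : FirstOrder.Language.{0, 0}) (M : Type) [L.Structure M] {m : ℕ}
    (c d : Fin m → M) : Prop :=
  (∀ i j, c i = c j ↔ d i = d j) ∧
    ∀ (l : ℕ) (R : L.Relations l) (σ : Fin l → Fin m),
      Structure.RelMap R (c ∘ σ) ↔ Structure.RelMap R (d ∘ σ)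

theorem isQF_iInf_s14 {L : FirstOrder.Language.{0, 0}} {ι α : Type} [Finite ι]
    {f : ι → L.Formula α} (hf : ∀ i, (f i).IsQF) : (Formula.iInf f).IsQF := by
  have foldr_isQF : ∀ l : List (L.Formula α), (∀ χ ∈ l, χ.IsQF) →
      BoundedFormula.IsQF (l.foldr (· ⊓ ·) ⊤) := by
    intro l
    induction l with
    | nil => exact fun _ => BoundedFormula.IsQF.top
    | cons χ l ih =>
      intro hl
      exact (hl χ (by simp)).inf (ih fun χ' h => hl χ' (by simp [h]))
  refine foldr_isQF _ fun χ hχ => ?_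
  obtain ⟨i, -, rfl⟩ := List.mem_map.1 hχ
  exact hf i

/-- For finitely many quantifier-free formulas, a single quantifier-free formula says which of
them hold of the tuple `c`. -/
theorem exists_isQF_realize_iff_s14 {L : FirstOrder.Language.{0, 0}} {M : Type} [L.Structure M]
    {ι α : Type} [Finite ι] (f : ι → L.Formula α) (hf : ∀ i, (f i).IsQF) (c : α → M) :
    ∃ θ : L.Formula α, θ.IsQF ∧
      ∀ d : α → M, θ.Realize d ↔ ∀ i, ((f i).Realize c ↔ (f i).Realize d) := by
  classical
  refine ⟨Formula.iInf fun i => if (f i).Realize c then f i else (f i).not,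
    isQF_iInf_s14 fun i => ?_, fun d => ?_⟩
  · split_ifs
    exacts [hf i, (hf i).not]
  · rw [Formula.realize_iInf]
    refine forall_congr' fun i => ?_
    split_ifs with h <;> simp [h]

/-- In a finite relational language, a single quantifier-free formula describes the atomic
diagram of a tuple. -/
theorem exists_isQF_realize_iff_sameAtomic (L : FirstOrder.Language.{0, 0})
    [Finite (Σ n : ℕ, L.Relations n)] {M : Type} [L.Structure M] {m : ℕ} (c : Fin m → M) :
    ∃ θ : L.Formula (Fin m), θ.IsQF ∧ ∀ d : Fin m → M, θ.Realize d ↔ SameAtomic L M c d := by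
  let f : (Fin m × Fin m) ⊕ (Σ r : (Σ n : ℕ, L.Relations n), (Fin r.1 → Fin m)) →
      L.Formula (Fin m) :=
    Sum.elim (fun p => (Term.var p.1).equal (Term.var p.2))
      (fun r => r.1.2.formula fun i => Term.var (r.2 i))
  have hf : ∀ x, (f x).IsQF := by
    rintro (p | r)
    · exact (BoundedFormula.IsAtomic.equal _ _).isQF
    · exact (BoundedFormula.IsAtomic.rel _ _).isQF
  obtain ⟨θ, hθ, hd⟩ := exists_isQF_realize_iff_s14 f hf c
  refine ⟨θ, hθ, fun d => (hd d).trans ?_⟩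
  simp only [f, Sum.forall, Prod.forall, Sigma.forall, Sum.elim_inl, Sum.elim_inr,
    Formula.realize_equal, Formula.realize_rel, Term.realize_var]
  rfl

/-- Quantifier-free formulas cannot distinguish tuples with the same atomic diagram. -/
theorem SameAtomic.realize_iff {L : FirstOrder.Language.{0, 0}} [L.IsRelational]
    {M : Type} [L.Structure M] {m : ℕ} {c d : Fin m → M} (h : SameAtomic L M c d)
    {α : Type} {n : ℕ} {ψ : L.BoundedFormula α n} (hψ : ψ.IsQF)
    (σ : α → Fin m) (τ : Fin n → Fin m) :
    ψ.Realize (c ∘ σ) (c ∘ τ) ↔ ψ.Realize (d ∘ σ) (d ∘ τ) := by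
  have realize_term : ∀ t : L.Term (α ⊕ Fin n), ∃ i : Fin m, ∀ e : Fin m → M,
      t.realize (Sum.elim (e ∘ σ) (e ∘ τ)) = e i := by
    rintro ((a | b) | ⟨g, -⟩)
    · exact ⟨σ a, fun _ => rfl⟩
    · exact ⟨τ b, fun _ => rfl⟩
    · exact isEmptyElim g
  choose v hv using realize_term
  induction hψ with
  | falsum => rfl
  | of_isAtomic hat =>
    cases hat with
    | equal t₁ t₂ =>
      simp only [BoundedFormula.realize_bdEqual, hv]
      exact h.1 _ _
    | rel R ts =>
      simp only [BoundedFormula.realize_rel, hv]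
      exact h.2 _ R fun i => v (ts i)
  | imp _ _ ih₁ ih₂ => simp only [BoundedFormula.realize_imp, ih₁, ih₂]

/-- An algebraic `Σ₁`-formula all of whose solutions, together with witnesses for them, lie in the
tuple `c` cannot distinguish `c` from tuples with the same atomic diagram. -/
theorem SameAtomic.realize_exs_iff {L : FirstOrder.Language.{0, 0}} [L.IsRelational]
    {M : Type} [L.Structure M] {m : ℕ} {c d : Fin m → M} (h : SameAtomic L M c d)
    {k n : ℕ} {ψ : L.BoundedFormula (Fin k) n} (hψ : ψ.IsQF)
    (hfin : {x : Fin k → M | ψ.exs.Realize x}.Finite)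
    (hc : ∀ x : Fin k → M, ψ.exs.Realize x →
      ∃ (σ : Fin k → Fin m) (τ : Fin n → Fin m), x = c ∘ σ ∧ ψ.Realize x (c ∘ τ))
    (σ : Fin k → Fin m) : ψ.exs.Realize (c ∘ σ) ↔ ψ.exs.Realize (d ∘ σ) := by
  have comp_eq_iff : ∀ σ₁ σ₂ : Fin k → Fin m, c ∘ σ₁ = c ∘ σ₂ ↔ d ∘ σ₁ = d ∘ σ₂ := by
    intro σ₁ σ₂
    simp only [funext_iff, Function.comp_apply, h.1]
  let S := {x : Fin k → M // ψ.exs.Realize x}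
  have : Finite S := hfin.to_subtype
  choose s t hs ht using fun x : S => hc x.1 x.2
  have realize_image : ∀ x : S, ψ.exs.Realize (d ∘ s x) := fun x => by
    refine BoundedFormula.realize_exs.2 ⟨d ∘ t x, (h.realize_iff hψ _ _).1 ?_⟩
    rw [← hs x]
    exact ht x
  let G : S → S := fun x => ⟨d ∘ s x, realize_image x⟩
  have hG : Function.Injective G := fun x y hxy => by
    apply Subtype.ext
    rw [hs x, hs y, comp_eq_iff]
    exact congrArg Subtype.val hxy
  constructor
  · intro hσ
    have := realize_image ⟨_, hσ⟩
    rwa [← (comp_eq_iff _ _).1 (hs ⟨_, hσ⟩)] at this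
  · intro hσ
    obtain ⟨x, hx⟩ := Finite.surjective_of_injective hG ⟨_, hσ⟩
    rw [← (comp_eq_iff _ _).2 (congrArg Subtype.val hx), ← hs x]
    exact x.2

/-- Tuples with the same atomic diagram in the homogeneous expansion have the same type. -/
theorem Homogenizes.sameType {L : FirstOrder.Language.{0, 0}} [L.IsRelational]
    {M : Type} [L.Structure M] {n : ℕ} {k : Fin n → ℕ} {φ : ∀ i : Fin n, L.Formula (Fin (k i))}
    (hφ : Homogenizes L M φ) {m : ℕ} {c d : Fin m → M} (h : SameAtomic L M c d)
    (hcd : ∀ (i : Fin n) (σ : Fin (k i) → Fin m),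
      (φ i).Realize (c ∘ σ) ↔ (φ i).Realize (d ∘ σ)) :
    SameType L M c d := by
  let : (expLang n k).Structure M := expStructure L M φ
  have hrel : (expLang n k).IsRelational := fun _ => inferInstanceAs (IsEmpty Empty)
  have hφ' : (L.sum (expLang n k)).IsUltrahomogeneous M := hφ
  let S : (L.sum (expLang n k)).Substructure M :=
    ⟨Set.range c, fun f => isEmptyElim f⟩
  have hS : S.FG := Substructure.fg_iff_finite.2 (Set.finite_range c).to_subtype
  choose v hv using fun x : S => x.2
  have hvc : ∀ i : Fin m, d (v ⟨c i, i, rfl⟩) = d i := fun i => (h.1 _ _).1 (hv _)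
  let F : S ↪[L.sum (expLang n k)] M :=
    { toFun := fun x => d (v x)
      inj' := fun x y hxy => by
        apply Subtype.ext
        rw [← hv x, ← hv y]
        exact (h.1 _ _).2 hxy
      map_fun' := fun f => isEmptyElim f
      map_rel' := by
        intro l R x
        have hx : (fun j => (x j : M)) = c ∘ fun j => v (x j) := funext fun j => (hv (x j)).symm
        change Structure.RelMap R (d ∘ fun j => v (x j)) ↔
          Structure.RelMap R (fun j => (x j : M))
        rw [hx]
        rcases R with R | ⟨i, rfl⟩
        · exact (h.2 _ R _).symm
        · exact (hcd i _).symm }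
  obtain ⟨g, hg⟩ := hφ' S hS F
  have hgc : ∀ i, g (c i) = d i := fun i => by
    rw [← hvc i]
    exact (DFunLike.congr_fun hg ⟨c i, i, rfl⟩).symm
  let gL : M ≃[L] M :=
    { g.toEquiv with
      map_fun' := fun f => isEmptyElim f
      map_rel' := fun R x => g.map_rel' (Sum.inl R) x }
  intro χ
  have hd : d = gL ∘ c := funext fun i => (hgc i).symm
  rw [hd, StrongHomClass.realize_formula]

/-- A `Σ₁`-homogenizable structure whose homogenizing formulas are all
algebraic is uniformly homogenizable. -/
theorem algebraic_sigma1_uniformlyHomogenizable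
    (L : FirstOrder.Language.{0, 0}) [L.IsRelational] [Finite (Σ n : ℕ, L.Relations n)]
    (M : Type) [L.Structure M]
    (h : ∃ (n : ℕ) (k : Fin n → ℕ) (φ : ∀ i : Fin n, L.Formula (Fin (k i))),
      (∀ i, IsSigma1 L (φ i)) ∧ Homogenizes L M φ ∧
      ∀ i, {x : Fin (k i) → M | (φ i).Realize x}.Finite) :
    UniformlyHomogenizable L M := by
  obtain ⟨n, k, φ, hsigma, hhom, hfin⟩ := h
  refine ⟨⟨n, k, φ, hhom⟩, ?_⟩
  choose r ψ hqf hφψ using hsigma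
  have exists_support : ∀ (i : Fin n) (x : Fin (k i) → M), ∃ T : Set M, T.Finite ∧
      ((φ i).Realize x → Set.range x ⊆ T ∧
        ∃ w : Fin (r i) → M, Set.range w ⊆ T ∧ (ψ i).Realize x w) := by
    intro i x
    by_cases hx : (φ i).Realize x
    · obtain ⟨w, hw⟩ := BoundedFormula.realize_exs.1 (hφψ i ▸ hx)
      exact ⟨Set.range x ∪ Set.range w, (Set.finite_range x).union (Set.finite_range w),
        fun _ => ⟨Set.subset_union_left, w, Set.subset_union_right, hw⟩⟩
    · exact ⟨∅, Set.finite_empty, fun hx' => absurd hx' hx⟩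
  choose T hT hTφ using exists_support
  let U : Set M := ⋃ i, ⋃ x ∈ {x | (φ i).Realize x}, T i x
  have hU : U.Finite := Set.finite_iUnion fun i => (hfin i).biUnion fun x _ => hT i x
  have : Finite U := hU.to_subtype
  let a : Fin (Nat.card U) → M := fun j => ((Finite.equivFin U).symm j : M)
  refine ⟨Nat.card U, a, fun q b => ?_⟩
  have exists_index : ∀ u ∈ U, ∃ j, Fin.append a b j = u := fun u hu =>
    ⟨Fin.castAdd q (Finite.equivFin U ⟨u, hu⟩),
      (Fin.append_left a b _).trans (congrArg Subtype.val (Equiv.symm_apply_apply _ _))⟩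
  have exists_comp : ∀ {l : ℕ} (y : Fin l → M), Set.range y ⊆ U →
      ∃ σ : Fin l → Fin (Nat.card U + q), y = Fin.append a b ∘ σ := fun y hy => by
    choose σ hσ using fun j => exists_index (y j) (hy ⟨j, rfl⟩)
    exact ⟨σ, funext fun j => (hσ j).symm⟩
  obtain ⟨θ, hθ, hθd⟩ := exists_isQF_realize_iff_sameAtomic L (Fin.append a b)
  refine ⟨θ, hθ, (hθd _).2 ⟨fun _ _ => Iff.rfl, fun _ _ _ => Iff.rfl⟩, fun d hd => ?_⟩
  have hsame := (hθd d).1 hd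
  refine hhom.sameType hsame fun i => ?_
  rw [hφψ i]
  refine hsame.realize_exs_iff (hqf i) (hφψ i ▸ hfin i) fun x hx => ?_
  have hx' : (φ i).Realize x := (hφψ i).symm ▸ hx
  have hTU : T i x ⊆ U := fun u hu => Set.mem_iUnion.2 ⟨i, Set.mem_biUnion hx' hu⟩
  obtain ⟨hxT, w, hwT, hw⟩ := hTφ i x hx'
  obtain ⟨σ, hσ⟩ := exists_comp x (hxT.trans hTU)
  obtain ⟨τ, rfl⟩ := exists_comp w (hwT.trans hTU)
  exact ⟨σ, τ, hσ, hw⟩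

end HomPaper
end

section
/- Let M be a structure over a finite relational vocabulary and let ξ(x,y) be the equivalence relation on M which holds between two elements if and only if they satisfy the same atomic diagram (the same quantifier-free 1-type). If M is k-unavoidably homogenizable, then for each infinite equivalence class A of ξ, the induced substructure M↾A is a k-unavoidably homogenizable structure. -/
open FirstOrder FirstOrder.Language CategoryTheory

namespace HomPaper

/-- Relativization: if the range of an embedding is defined by `θ`, then every formula over the
domain is the restriction of a formula over the codomain. -/
theorem exists_relativization {L : FirstOrder.Language.{0, 0}} {N M α : Type}
    [L.Structure N] [L.Structure M] (f : N ↪[L] M) (θ : L.Formula (Fin 1))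
    (hθ : ∀ b : M, θ.Realize (fun _ => b) ↔ b ∈ Set.range f) {n : ℕ}
    (φ : L.BoundedFormula α n) :
    ∃ ψ : L.BoundedFormula α n, ∀ (v : α → N) (xs : Fin n → N),
      ψ.Realize (f ∘ v) (f ∘ xs) ↔ φ.Realize v xs := by
  induction φ with
  | falsum => exact ⟨.falsum, fun _ _ => Iff.rfl⟩
  | equal t₁ t₂ =>
    exact ⟨_, fun _ _ => (BoundedFormula.IsAtomic.equal t₁ t₂).isQF.realize_embedding f⟩
  | rel R ts =>
    exact ⟨_, fun _ _ => (BoundedFormula.IsAtomic.rel R ts).isQF.realize_embedding f⟩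
  | imp _ _ ih₁ ih₂ =>
    obtain ⟨ψ₁, h₁⟩ := ih₁
    obtain ⟨ψ₂, h₂⟩ := ih₂
    exact ⟨ψ₁.imp ψ₂, fun v xs => by simp only [BoundedFormula.realize_imp, h₁, h₂]⟩
  | @all n _ ih =>
    obtain ⟨ψ, h⟩ := ih
    let guard : L.BoundedFormula α (n + 1) :=
      BoundedFormula.relabel (k := 0) (fun _ => Sum.inr (Fin.last n)) θ
    have hguard (v : α → M) (xs : Fin n → M) (b : M) :
        guard.Realize v (Fin.snoc xs b) ↔ b ∈ Set.range f := by
      rw [← hθ b, Formula.Realize]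
      refine BoundedFormula.realize_relabel.trans (iff_of_eq ?_)
      congr 1
      · funext i
        exact Fin.snoc_last (α := fun _ => M) b xs
      · exact Subsingleton.elim _ _
    refine ⟨(guard.imp ψ).all, fun v xs => ?_⟩
    simp only [BoundedFormula.realize_all, BoundedFormula.realize_imp, hguard,
      Set.forall_mem_range, ← Fin.comp_snoc, h]

/-- Over a finite relational language, each class of the same-atomic-diagram relation is
definable. -/
theorem exists_formula_sameAtomic1 (L : FirstOrder.Language.{0, 0}) [L.IsRelational]
    [Finite (Σ n : ℕ, L.Relations n)] (M : Type) [L.Structure M] (a : M) :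
    ∃ θ : L.Formula (Fin 1), ∀ b : M, θ.Realize (fun _ => b) ↔ SameAtomic1 L M a b := by
  classical
  let diagonal (R : Σ n : ℕ, L.Relations n) : L.Formula (Fin 1) :=
    R.2.formula fun _ => Term.var 0
  have hterm (b : M) (xs : Fin 0 → M) (t : L.Term (Fin 1 ⊕ Fin 0)) :
      t.realize (Sum.elim (fun _ => b) xs) = b := by
    rcases t with (_ | i) | ⟨F, _⟩
    · rfl
    · exact i.elim0
    · exact isEmptyElim F
  refine ⟨Formula.iInf fun R =>
    if (diagonal R).Realize (fun _ => a) then diagonal R else (diagonal R).not, fun b => ?_⟩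
  rw [Formula.realize_iInf]
  have hsign (R : Σ n : ℕ, L.Relations n) :
      Formula.Realize (if (diagonal R).Realize (fun _ => a) then diagonal R
        else (diagonal R).not) (fun _ => b) ↔
      ((diagonal R).Realize (fun _ => a) ↔ (diagonal R).Realize (fun _ => b)) := by
    split_ifs with hR <;> simp [hR]
  simp only [hsign]
  constructor
  · rintro hb _ (⟨t₁, t₂⟩ | ⟨R, ts⟩)
    · simp [Formula.Realize, hterm]
    · simp only [Formula.Realize, BoundedFormula.realize_rel, hterm]
      simpa [diagonal, Formula.realize_rel] using hb ⟨_, R⟩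
  · exact fun hb R => hb _ (BoundedFormula.IsAtomic.rel _ _)

/-- The inclusion of a subset with its induced structure, as an embedding. -/
def inducedEmbedding (L : FirstOrder.Language.{0, 0}) [L.IsRelational] (M : Type)
    [L.Structure M] (A : Set M) :
    letI := inducedStructure L M A
    A ↪[L] M :=
  letI := inducedStructure L M A
  { toEmbedding := Function.Embedding.subtype _
    map_fun' := fun F => isEmptyElim F
    map_rel' := fun _ _ => Iff.rfl }

/-- Quantifier-free isolation passes to structures embedded with definable range. -/
theorem QFIsolated.of_embedding {L : FirstOrder.Language.{0, 0}} {N M : Type}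
    [L.Structure N] [L.Structure M] (f : N ↪[L] M) (θ : L.Formula (Fin 1))
    (hθ : ∀ b : M, θ.Realize (fun _ => b) ↔ b ∈ Set.range f) {m : ℕ} {x : Fin m → N}
    (hx : QFIsolated L M (f ∘ x)) : QFIsolated L N x := by
  obtain ⟨φ, hφ, hφx, hiso⟩ := hx
  have hrestrict (y : Fin m → N) : φ.Realize (f ∘ y) ↔ φ.Realize y := by
    rw [Formula.Realize, Formula.Realize, ← hφ.realize_embedding f,
      Subsingleton.elim (f ∘ default) default]
  refine ⟨φ, hφ, (hrestrict x).1 hφx, fun y hy χ => ?_⟩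
  obtain ⟨ψ, hψ⟩ := exists_relativization f θ hθ χ
  have hxy : Formula.Realize ψ (f ∘ x) ↔ Formula.Realize ψ (f ∘ y) :=
    hiso _ ((hrestrict y).2 hy) ψ
  rw [Formula.Realize, Formula.Realize, Subsingleton.elim (default : Fin 0 → M) (f ∘ default),
    hψ, hψ] at hxy
  exact hxy

/-- Infinite classes of the same-atomic-diagram equivalence relation in a
`k`-unavoidably homogenizable structure induce `k`-unavoidably homogenizable structures. -/
theorem sameAtomicClass_kUnavoidablyHomogenizable
    (L : FirstOrder.Language.{0, 0}) [L.IsRelational] [Finite (Σ n : ℕ, L.Relations n)]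
    (M : Type) [L.Structure M] (k : ℕ)
    (h : KUnavoidablyHomogenizable L M k) (a : M)
    (hinf : {b : M | SameAtomic1 L M a b}.Infinite) :
    @KUnavoidablyHomogenizable L ↥{b : M | SameAtomic1 L M a b}
      (inducedStructure L M {b : M | SameAtomic1 L M a b}) k := by
  let _ := inducedStructure L M {b : M | SameAtomic1 L M a b}
  obtain ⟨θ, hθ⟩ := exists_formula_sameAtomic1 L M a
  intro n hn x
  let f := inducedEmbedding L M {b : M | SameAtomic1 L M a b}
  have hrange : Set.range f = {b : M | SameAtomic1 L M a b} := Subtype.range_coe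
  exact QFIsolated.of_embedding f θ (fun b => by rw [hθ, hrange, Set.mem_ofPred_eq])
    (h n hn (f ∘ x))

end HomPaper
end
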